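/- Let 6/5 < γ < 2 with γ ≠ 4/3. Suppose u₀ and u₁ are two functions, each radially symmetric, positive on an open ball centered at the origin (of radii R₀ and R₁ respectively), continuous on the closed ball, twice continuously differentiable inside, vanishing on the boundary sphere, and satisfying Δu + 4π u^{1/(γ−1)} = 0 inside the ball. If their total masses agree, ∫_{B_{R₀}} u₀^{1/(γ−1)} dx = ∫_{B_{R₁}} u₁^{1/(γ−1)} dx, then R₀ = R₁ and u₀ = u₁. In particular, for γ ≠ 4/3 the map from central value a = u(0) to total mass M(a) is strictly monotone, so two distinct non-rotating Lane–Emden stars cannot have the same mass. -/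

import Mathlib

open MeasureTheory Real

/-- The Laplacian on `ℝ³`: sum of the pure second directional derivatives along the
standard orthonormal basis. -/
noncomputable def lap (u : EuclideanSpace ℝ (Fin 3) → ℝ) (x : EuclideanSpace ℝ (Fin 3)) : ℝ :=
  ∑ i : Fin 3, iteratedFDeriv ℝ 2 u x ![EuclideanSpace.single i 1, EuclideanSpace.single i 1]

/-- `u` is a positive radial Dirichlet solution of the Lane–Emden equation
`Δu + 4π u^{1/(γ−1)} = 0` on the ball of radius `R`. -/
def IsLaneEmdenSolution (γ R : ℝ) (u : EuclideanSpace ℝ (Fin 3) → ℝ) : Prop :=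
  (∀ x y : EuclideanSpace ℝ (Fin 3), ‖x‖ = ‖y‖ → u x = u y) ∧
  (∀ x ∈ Metric.ball (0 : EuclideanSpace ℝ (Fin 3)) R, 0 < u x) ∧
  ContinuousOn u (closure (Metric.ball (0 : EuclideanSpace ℝ (Fin 3)) R)) ∧
  ContDiffOn ℝ 2 u (Metric.ball (0 : EuclideanSpace ℝ (Fin 3)) R) ∧
  (∀ x ∈ Metric.sphere (0 : EuclideanSpace ℝ (Fin 3)) R, u x = 0) ∧
  (∀ x ∈ Metric.ball (0 : EuclideanSpace ℝ (Fin 3)) R,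
    lap u x + 4 * π * u x ^ (1 / (γ - 1)) = 0)

/-- `f`, with derivatives `f'` and `f''`, is the radial profile of a positive solution of
`Δu + 4π u^p = 0` on the ball of radius `R` in `ℝ³` vanishing on the boundary. -/
structure IsLaneEmdenProfile (p R : ℝ) (f f' f'' : ℝ → ℝ) : Prop where
  hasDerivAt : ∀ t ∈ Set.Ioo (-R) R, HasDerivAt f (f' t) t
  hasDerivAt' : ∀ t ∈ Set.Ioo (-R) R, HasDerivAt f' (f'' t) t
  deriv_zero : f' 0 = 0
  ode : ∀ t ∈ Set.Ioo 0 R, f'' t + 2 / t * f' t + 4 * π * f t ^ p = 0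
  pos : ∀ t ∈ Set.Ioo (-R) R, 0 < f t
  boundary : f R = 0
  continuousOn : ContinuousOn f (Set.Icc 0 R)

/-- For `p ≥ 1` the power `x ↦ x ^ p` is Lipschitz on `[0, M]`. -/
lemma exists_abs_rpow_sub_le {p : ℝ} (hp : 1 ≤ p) (M : ℝ) :
    ∃ K, 0 ≤ K ∧ ∀ x ∈ Set.Icc 0 M, ∀ y ∈ Set.Icc 0 M, |x ^ p - y ^ p| ≤ K * |x - y| := by
  rcases lt_or_ge M 0 with hM | hM
  · exact ⟨0, le_rfl, fun x hx => absurd (hx.1.trans hx.2) (not_le.2 hM)⟩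
  refine ⟨p * M ^ (p - 1), by positivity, fun x hx y hy => ?_⟩
  have := (convex_Icc (0 : ℝ) M).norm_image_sub_le_of_norm_hasDerivWithin_le
    (f := fun x : ℝ => x ^ p) (f' := fun x => p * x ^ (p - 1)) (C := p * M ^ (p - 1))
    (fun z _ => (Real.hasDerivAt_rpow_const (Or.inr hp)).hasDerivWithinAt)
    (fun z hz => by
      rw [Real.norm_of_nonneg (mul_nonneg (by linarith) (Real.rpow_nonneg hz.1 _))]
      exact mul_le_mul_of_nonneg_left (Real.rpow_le_rpow hz.1 hz.2 (by linarith)) (by linarith))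
    hy hx
  simpa [Real.norm_eq_abs] using this

namespace IsLaneEmdenProfile

variable {p R S : ℝ} {f f' f'' g g' g'' : ℝ → ℝ}

/-- Profiles with the same central value agree as long as both are positive. -/
lemma eq_of_lt (hp : 1 ≤ p) (hf : IsLaneEmdenProfile p R f f' f'')
    (hg : IsLaneEmdenProfile p S g g' g'') (h0 : f 0 = g 0) {ρ : ℝ} (hρ : 0 ≤ ρ)
    (hR : ρ < R) (hS : ρ < S) : f ρ = g ρ := by
  have memR : ∀ t ∈ Set.Icc 0 ρ, t ∈ Set.Ioo (-R) R := fun t ht =>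
    ⟨by linarith [ht.1], by linarith [ht.2]⟩
  have memS : ∀ t ∈ Set.Icc 0 ρ, t ∈ Set.Ioo (-S) S := fun t ht =>
    ⟨by linarith [ht.1], by linarith [ht.2]⟩
  obtain ⟨M₁, hM₁⟩ := (isCompact_Icc (a := (0 : ℝ)) (b := ρ)).bddAbove_image
    (f := f) (fun t ht => (hf.hasDerivAt t (memR t ht)).continuousAt.continuousWithinAt)
  obtain ⟨M₂, hM₂⟩ := (isCompact_Icc (a := (0 : ℝ)) (b := ρ)).bddAbove_image
    (f := g) (fun t ht => (hg.hasDerivAt t (memS t ht)).continuousAt.continuousWithinAt)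
  obtain ⟨K₀, hK₀, hLip⟩ := exists_abs_rpow_sub_le hp (max M₁ M₂)
  set K : ℝ := 4 * π * K₀ with hK
  have hKnn : 0 ≤ K := by positivity
  set F : ℝ → ℝ := fun t =>
    ((f t - g t) ^ 2 + (f' t - g' t) ^ 2) * Real.exp (-(1 + K) * t) with hF
  have hFd : ∀ t ∈ Set.Icc 0 ρ, HasDerivAt F
      ((2 * (f t - g t) * (f' t - g' t) + 2 * (f' t - g' t) * (f'' t - g'' t)) *
        Real.exp (-(1 + K) * t) + ((f t - g t) ^ 2 + (f' t - g' t) ^ 2) *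
        (Real.exp (-(1 + K) * t) * (-(1 + K)))) t := by
    intro t ht
    have h1 := ((hf.hasDerivAt t (memR t ht)).sub (hg.hasDerivAt t (memS t ht))).pow 2
    have h2 := ((hf.hasDerivAt' t (memR t ht)).sub (hg.hasDerivAt' t (memS t ht))).pow 2
    have h3 := ((hasDerivAt_id t).const_mul (-(1 + K))).exp
    refine ((h1.add h2).mul h3).congr_deriv ?_
    simp
  have hanti : AntitoneOn F (Set.Icc 0 ρ) := by
    refine antitoneOn_of_deriv_nonpos (convex_Icc 0 ρ)
      (fun t ht => (hFd t ht).continuousAt.continuousWithinAt)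
      (fun t ht => (hFd t (interior_subset ht)).differentiableAt.differentiableWithinAt) ?_
    intro t ht
    have htI := interior_subset ht
    rw [interior_Icc] at ht
    rw [(hFd t htI).deriv]
    have e1 := hf.ode t ⟨ht.1, by linarith [ht.2]⟩
    have e2 := hg.ode t ⟨ht.1, by linarith [ht.2]⟩
    have hb : |4 * π * (f t ^ p - g t ^ p)| ≤ K * |f t - g t| := by
      rw [abs_mul, abs_of_pos (by positivity : 0 < 4 * π), hK, mul_assoc (4 * π)]
      refine mul_le_mul_of_nonneg_left (hLip _ ⟨(hf.pos t (memR t htI)).le, ?_⟩ _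
        ⟨(hg.pos t (memS t htI)).le, ?_⟩) (by positivity)
      · exact (hM₁ (Set.mem_image_of_mem _ htI)).trans (le_max_left _ _)
      · exact (hM₂ (Set.mem_image_of_mem _ htI)).trans (le_max_right _ _)
    have hdd : f'' t - g'' t = -(2 / t * (f' t - g' t)) - 4 * π * (f t ^ p - g t ^ p) := by
      linarith
    rw [hdd]
    generalize 4 * π * (f t ^ p - g t ^ p) = h at hb
    generalize f t - g t = d at hb
    generalize f' t - g' t = e
    have h2t : 0 ≤ 2 / t := by have := ht.1; positivity
    have hcross : -(2 * e * h) ≤ K * (d ^ 2 + e ^ 2) := by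
      have : -(2 * e * h) ≤ 2 * |e| * (K * |d|) := by
        calc -(2 * e * h) ≤ |2 * e * h| := neg_le_abs _
          _ = 2 * |e| * |h| := by rw [abs_mul, abs_mul, abs_two]
          _ ≤ _ := by gcongr
      nlinarith [mul_nonneg hKnn (sq_nonneg (|e| - |d|)), sq_abs e, sq_abs d]
    have hE : 2 * d * e + 2 * e * (-(2 / t * e) - h) - (1 + K) * (d ^ 2 + e ^ 2) ≤ 0 := by
      nlinarith [mul_nonneg h2t (sq_nonneg e), sq_nonneg (d - e)]
    have := mul_nonpos_of_nonpos_of_nonneg hE (Real.exp_pos (-(1 + K) * t)).le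
    linarith
  have hle := hanti (Set.left_mem_Icc.2 hρ) (Set.right_mem_Icc.2 hρ) hρ
  have hF0 : F 0 = 0 := by simp [hF, h0, hf.deriv_zero, hg.deriv_zero]
  rw [hF0] at hle
  have hsum : (f ρ - g ρ) ^ 2 + (f' ρ - g' ρ) ^ 2 ≤ 0 :=
    nonpos_of_mul_nonpos_left hle (Real.exp_pos _)
  have : (f ρ - g ρ) ^ 2 = 0 := by nlinarith [sq_nonneg (f ρ - g ρ), sq_nonneg (f' ρ - g' ρ)]
  exact sub_eq_zero.1 (pow_eq_zero_iff two_ne_zero |>.1 this)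

lemma eqOn_Icc_min (hp : 1 ≤ p) (hf : IsLaneEmdenProfile p R f f' f'')
    (hg : IsLaneEmdenProfile p S g g' g'') (h0 : f 0 = g 0) (hR : 0 < R) (hS : 0 < S) :
    Set.EqOn f g (Set.Icc 0 (min R S)) := by
  have h : Set.EqOn f g (Set.Ico 0 (min R S)) := fun t ht =>
    hf.eq_of_lt hp hg h0 ht.1 (ht.2.trans_le (min_le_left _ _)) (ht.2.trans_le (min_le_right _ _))
  refine h.of_subset_closure
    (hf.continuousOn.mono (Set.Icc_subset_Icc_right (min_le_left _ _)))
    (hg.continuousOn.mono (Set.Icc_subset_Icc_right (min_le_right _ _)))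
    Set.Ico_subset_Icc_self ?_
  rw [closure_Ico (lt_min hR hS).ne]

/-- Profiles with the same central value have the same radius. -/
lemma radius_le (hp : 1 ≤ p) (hf : IsLaneEmdenProfile p R f f' f'')
    (hg : IsLaneEmdenProfile p S g g' g'') (h0 : f 0 = g 0) (hR : 0 < R) (hS : 0 < S) :
    S ≤ R := by
  by_contra! hlt
  have h := hf.eqOn_Icc_min hp hg h0 hR hS ⟨hR.le, le_min le_rfl hlt.le⟩
  have := hg.pos R ⟨by linarith, hlt⟩
  rw [← h, hf.boundary] at this
  exact lt_irrefl _ this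

/-- The Lane–Emden scaling symmetry. -/
lemma scale (hp : 1 < p) (hf : IsLaneEmdenProfile p R f f' f'') {l : ℝ} (hl : 0 < l) :
    IsLaneEmdenProfile p (R / l) (fun t => l ^ (2 / (p - 1)) * f (l * t))
      (fun t => l ^ (2 / (p - 1)) * (l * f' (l * t)))
      (fun t => l ^ (2 / (p - 1)) * (l * (l * f'' (l * t)))) := by
  have hmem : ∀ t ∈ Set.Ioo (-(R / l)) (R / l), l * t ∈ Set.Ioo (-R) R := by
    intro t ht
    have h1 := ht.1
    have h2 := ht.2
    rw [← neg_div, div_lt_iff₀' hl] at h1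
    rw [lt_div_iff₀' hl] at h2
    exact ⟨h1, h2⟩
  have hlin : ∀ t, HasDerivAt (fun t : ℝ => l * t) l t := fun t => by
    simpa using (hasDerivAt_id t).const_mul l
  refine ⟨fun t ht => ?_, fun t ht => ?_, ?_, fun t ht => ?_, fun t ht => ?_, ?_, ?_⟩
  · have := ((hf.hasDerivAt _ (hmem t ht)).comp t (hlin t)).const_mul (l ^ (2 / (p - 1)))
    rw [mul_comm (f' _)] at this
    exact this
  · have := (((hf.hasDerivAt' _ (hmem t ht)).comp t (hlin t)).const_mul l).const_mul
      (l ^ (2 / (p - 1)))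
    rw [mul_comm (f'' _)] at this
    exact this
  · simp [hf.deriv_zero]
  · have ht' := hmem t ⟨by linarith [ht.1, ht.2], ht.2⟩
    have hode := hf.ode (l * t) ⟨mul_pos hl ht.1, ht'.2⟩
    have htpos := ht.1
    have hpow : (l ^ (2 / (p - 1)) * f (l * t)) ^ p
        = l ^ (2 / (p - 1)) * l ^ 2 * f (l * t) ^ p := by
      rw [Real.mul_rpow (by positivity) (hf.pos _ ht').le, ← Real.rpow_mul hl.le,
        ← Real.rpow_natCast l 2, ← Real.rpow_add hl]
      congr 2
      have : p - 1 ≠ 0 := by linarith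
      field_simp
      push_cast
      ring
    simp only [hpow]
    have : l ^ (2 / (p - 1)) * l ^ 2 *
        (f'' (l * t) + 2 / (l * t) * f' (l * t) + 4 * π * f (l * t) ^ p) = 0 := by
      rw [hode, mul_zero]
    rw [← this]
    field_simp
  · have := hf.pos _ (hmem t ht)
    positivity
  · simp [mul_div_cancel₀ R hl.ne', hf.boundary]
  · refine continuousOn_const.mul (hf.continuousOn.comp (by fun_prop) fun t ht => ?_)
    have h2 := ht.2
    rw [le_div_iff₀' hl] at h2
    exact ⟨mul_nonneg hl.le ht.1, h2⟩

end IsLaneEmdenProfile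

section SecondDerivative

variable {E : Type*} [NormedAddCommGroup E] [NormedSpace ℝ E] {u : E → ℝ} {s : Set E}

lemma ContDiffOn.hasDerivAt_line (hu : ContDiffOn ℝ 2 u s) (hs : IsOpen s) {x v : E} {t : ℝ}
    (h : x + t • v ∈ s) :
    HasDerivAt (fun t : ℝ => u (x + t • v)) (fderiv ℝ u (x + t • v) v) t := by
  have h1 := ((hu.contDiffAt (hs.mem_nhds h)).differentiableAt (by norm_num)).hasFDerivAt
  have h2 : HasDerivAt (fun t : ℝ => x + t • v) v t := by
    simpa using ((hasDerivAt_id t).smul_const v).const_add x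
  exact h1.comp_hasDerivAt t h2

lemma ContDiffOn.hasDerivAt_fderiv_line (hu : ContDiffOn ℝ 2 u s) (hs : IsOpen s) {x v : E}
    {t : ℝ} (h : x + t • v ∈ s) :
    HasDerivAt (fun t : ℝ => fderiv ℝ u (x + t • v) v)
      (iteratedFDeriv ℝ 2 u (x + t • v) ![v, v]) t := by
  have h1 := (((hu.contDiffAt (hs.mem_nhds h)).fderiv_right (m := 1)
    (by norm_num)).differentiableAt (by norm_num)).hasFDerivAt
  have h2 : HasDerivAt (fun t : ℝ => x + t • v) v t := by
    simpa using ((hasDerivAt_id t).smul_const v).const_add x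
  have h3 : HasDerivAt (fun t : ℝ => fderiv ℝ u (x + t • v)) _ t :=
    HasFDerivAt.comp_hasDerivAt (l := fderiv ℝ u) t h1 h2
  rw [iteratedFDeriv_two_apply]
  simpa using h3.clm_apply (hasDerivAt_const t v)

end SecondDerivative

lemma norm_smul_single_add_smul_single {i : Fin 3} (hi : i ≠ 0) (t s : ℝ) :
    ‖t • EuclideanSpace.single (0 : Fin 3) (1 : ℝ) + s • EuclideanSpace.single i (1 : ℝ)‖
      = √(t ^ 2 + s ^ 2) := by
  rw [EuclideanSpace.norm_eq, Fin.sum_univ_three]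
  congr 1
  fin_cases i <;> simp_all

lemma norm_smul_single_zero (t : ℝ) :
    ‖t • EuclideanSpace.single (0 : Fin 3) (1 : ℝ)‖ = |t| := by
  simp [norm_smul]

/-- Transversal second derivative of a radial function. -/
lemma iteratedFDeriv_two_transversal {u : EuclideanSpace ℝ (Fin 3) → ℝ} {R : ℝ}
    (hrad : ∀ x y : EuclideanSpace ℝ (Fin 3), ‖x‖ = ‖y‖ → u x = u y)
    (hu : ContDiffOn ℝ 2 u (Metric.ball 0 R)) {i : Fin 3} (hi : i ≠ 0) {t : ℝ}
    (ht : t ∈ Set.Ioo 0 R) :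
    iteratedFDeriv ℝ 2 u (t • EuclideanSpace.single 0 1)
        ![EuclideanSpace.single i 1, EuclideanSpace.single i 1]
      = fderiv ℝ u (t • EuclideanSpace.single 0 1) (EuclideanSpace.single 0 1) / t := by
  obtain ⟨ht0, htR⟩ := ht
  set e₀ : EuclideanSpace ℝ (Fin 3) := EuclideanSpace.single 0 1 with he₀
  set e : EuclideanSpace ℝ (Fin 3) := EuclideanSpace.single i 1 with he
  have hball : ∀ r : ℝ, |r| < R → (0 : EuclideanSpace ℝ (Fin 3)) + r • e₀ ∈ Metric.ball 0 R := by
    intro r hr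
    rw [zero_add, mem_ball_zero_iff, he₀, norm_smul_single_zero]
    exact hr
  have hq0 : √(t ^ 2 + (0 : ℝ) ^ 2) = t := by simp [Real.sqrt_sq ht0.le]
  have hqd : ∀ s : ℝ, HasDerivAt (fun s : ℝ => √(t ^ 2 + s ^ 2)) (s / √(t ^ 2 + s ^ 2)) s := by
    intro s
    have h1 : HasDerivAt (fun s : ℝ => t ^ 2 + s ^ 2) (2 * s) s := by
      simpa using (hasDerivAt_pow 2 s).const_add (t ^ 2)
    convert h1.sqrt (by positivity) using 1
    rw [mul_div_mul_left _ _ two_ne_zero]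
  have hq : ∀ᶠ s in nhds (0 : ℝ), √(t ^ 2 + s ^ 2) < R :=
    (hqd 0).continuousAt.eventually_lt_const (by simpa only [hq0] using htR)
  have hu0 := fun {r : ℝ} (hr : |r| < R) => hu.hasDerivAt_line Metric.isOpen_ball (hball r hr)
  have hu1 := fun {r : ℝ} (hr : |r| < R) =>
    hu.hasDerivAt_fderiv_line Metric.isOpen_ball (hball r hr)
  simp only [zero_add] at hu0 hu1
  have hnorm : ∀ s : ℝ, ‖t • e₀ + s • e‖ = √(t ^ 2 + s ^ 2) :=
    norm_smul_single_add_smul_single hi t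
  have hpull : (fun s : ℝ => u (t • e₀ + s • e)) = fun s : ℝ => u (√(t ^ 2 + s ^ 2) • e₀) := by
    funext s
    apply hrad
    rw [hnorm, he₀, norm_smul_single_zero, abs_of_nonneg (Real.sqrt_nonneg _)]
  have hev : (fun s : ℝ => fderiv ℝ u (t • e₀ + s • e) e) =ᶠ[nhds 0] fun s : ℝ =>
      fderiv ℝ u (√(t ^ 2 + s ^ 2) • e₀) e₀ * (s / √(t ^ 2 + s ^ 2)) := by
    filter_upwards [hq] with s hs
    have h1 := hu.hasDerivAt_line Metric.isOpen_ball (x := t • e₀) (v := e) (t := s)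
      (by rw [mem_ball_zero_iff, hnorm]; exact hs)
    rw [hpull] at h1
    exact h1.unique ((hu0 (by rwa [abs_of_nonneg (Real.sqrt_nonneg _)])).comp s (hqd s))
  have hL := hu.hasDerivAt_fderiv_line Metric.isOpen_ball (x := t • e₀) (v := e) (t := 0)
      (by rw [mem_ball_zero_iff, hnorm, hq0]; exact htR)
  have hA : HasDerivAt (fun s : ℝ => fderiv ℝ u (√(t ^ 2 + s ^ 2) • e₀) e₀) _ 0 :=
    HasDerivAt.comp (0 : ℝ) (h₂ := fun r : ℝ => fderiv ℝ u (r • e₀) e₀) (hu1 (r := √(t ^ 2 + (0 : ℝ) ^ 2))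
      (by rw [hq0, abs_of_pos ht0]; exact htR)) (hqd 0)
  have hB := (hasDerivAt_id (0 : ℝ)).div (hqd 0) (by rw [hq0]; exact ht0.ne')
  have := hL.unique ((hA.mul hB).congr_of_eventuallyEq hev)
  simp only [zero_smul, add_zero] at this
  rw [this]
  simp [Real.sqrt_sq ht0.le]
  field_simp

lemma IsLaneEmdenSolution.isLaneEmdenProfile {γ R : ℝ} {u : EuclideanSpace ℝ (Fin 3) → ℝ}
    (h : IsLaneEmdenSolution γ R u) (hR : 0 < R) :
    IsLaneEmdenProfile (1 / (γ - 1)) R (fun t => u (t • EuclideanSpace.single 0 1))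
      (fun t => fderiv ℝ u (t • EuclideanSpace.single 0 1) (EuclideanSpace.single 0 1))
      (fun t => iteratedFDeriv ℝ 2 u (t • EuclideanSpace.single 0 1)
        ![EuclideanSpace.single 0 1, EuclideanSpace.single 0 1]) := by
  obtain ⟨hrad, hpos, hcont, hu, hbd, hpde⟩ := h
  have hball : ∀ t ∈ Set.Ioo (-R) R,
      t • EuclideanSpace.single (0 : Fin 3) (1 : ℝ) ∈ Metric.ball 0 R := by
    intro t ht
    rw [mem_ball_zero_iff, norm_smul_single_zero]
    exact abs_lt.2 ht
  have hd : ∀ t ∈ Set.Ioo (-R) R,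
      HasDerivAt (fun t : ℝ => u (t • EuclideanSpace.single 0 1))
        (fderiv ℝ u (t • EuclideanSpace.single 0 1) (EuclideanSpace.single 0 1)) t := by
    intro t ht
    have := hu.hasDerivAt_line Metric.isOpen_ball (x := 0)
      (v := EuclideanSpace.single (0 : Fin 3) (1 : ℝ)) (t := t) (by rw [zero_add]; exact hball t ht)
    simpa only [zero_add] using this
  refine ⟨hd, fun t ht => ?_, ?_, fun t ht => ?_, fun t ht => hpos _ (hball t ht), ?_, ?_⟩
  · have := hu.hasDerivAt_fderiv_line Metric.isOpen_ball (x := 0)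
      (v := EuclideanSpace.single (0 : Fin 3) (1 : ℝ)) (t := t) (by rw [zero_add]; exact hball t ht)
    simpa only [zero_add] using this
  · have h0 := hd 0 ⟨by linarith, hR⟩
    have heven : (fun t : ℝ => u (-t • EuclideanSpace.single 0 1))
        = fun t : ℝ => u (t • EuclideanSpace.single 0 1) := by
      funext t
      apply hrad
      rw [norm_smul_single_zero, norm_smul_single_zero, abs_neg]
    have h1 : HasDerivAt (fun t : ℝ => u (-t • EuclideanSpace.single 0 1)) _ 0 :=
      HasDerivAt.comp (0 : ℝ) (h₂ := fun t : ℝ => u (t • EuclideanSpace.single 0 1))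
        (h := fun t : ℝ => -t) (by rw [neg_zero]; exact h0) (hasDerivAt_neg 0)
    rw [heven] at h1
    have := h0.unique h1
    linarith
  · have ht' : t ∈ Set.Ioo (-R) R := ⟨by linarith [ht.1, ht.2], ht.2⟩
    have := hpde _ (hball t ht')
    rw [lap, Fin.sum_univ_three, iteratedFDeriv_two_transversal hrad hu one_ne_zero ht,
      iteratedFDeriv_two_transversal hrad hu (i := 2) (by decide) ht] at this
    rw [← this]
    ring
  · apply hbd
    rw [mem_sphere_zero_iff_norm, norm_smul_single_zero, abs_of_pos hR]
  · refine hcont.comp (by fun_prop) fun t ht => ?_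
    rw [closure_ball _ hR.ne', mem_closedBall_zero_iff, norm_smul_single_zero, abs_of_nonneg ht.1]
    exact ht.2

lemma IsLaneEmdenSolution.mass_pos {γ R : ℝ} {u : EuclideanSpace ℝ (Fin 3) → ℝ}
    (h : IsLaneEmdenSolution γ R u) (hR : 0 < R) (hγ : 1 < γ) :
    0 < ∫ x in Metric.ball (0 : EuclideanSpace ℝ (Fin 3)) R, u x ^ (1 / (γ - 1)) := by
  obtain ⟨-, hpos, hcont, -, -, -⟩ := h
  have hp : 0 ≤ 1 / (γ - 1) := by
    have : 0 < γ - 1 := by linarith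
    positivity
  have hint : IntegrableOn (fun x => u x ^ (1 / (γ - 1))) (Metric.ball 0 R) := by
    rw [closure_ball _ hR.ne'] at hcont
    exact ((hcont.rpow_const fun x _ => Or.inr hp).integrableOn_compact
      (isCompact_closedBall _ _)).mono_set Metric.ball_subset_closedBall
  rw [setIntegral_pos_iff_support_of_nonneg_ae _ hint]
  · refine (Metric.measure_ball_pos volume (0 : EuclideanSpace ℝ (Fin 3)) hR).trans_le
      (measure_mono fun x hx => ⟨?_, hx⟩)
    exact (Real.rpow_pos_of_pos (hpos x hx) _).ne'
  · filter_upwards [ae_restrict_mem measurableSet_ball] with x hx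
    exact Real.rpow_nonneg (hpos x hx).le _

/-- Any two Lane–Emden stars are related by the scaling symmetry. -/
lemma IsLaneEmdenSolution.exists_scaling {γ R₀ R₁ : ℝ} (hγ₁ : 1 < γ) (hγ₂ : γ < 2)
    (hR₀ : 0 < R₀) (hR₁ : 0 < R₁) {u₀ u₁ : EuclideanSpace ℝ (Fin 3) → ℝ}
    (h₀ : IsLaneEmdenSolution γ R₀ u₀) (h₁ : IsLaneEmdenSolution γ R₁ u₁) :
    ∃ l : ℝ, 0 < l ∧ R₁ = R₀ / l ∧
      ∀ x ∈ Metric.closedBall (0 : EuclideanSpace ℝ (Fin 3)) R₁,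
        u₁ x = l ^ (2 / (1 / (γ - 1) - 1)) * u₀ (l • x) := by
  have hp : 1 < 1 / (γ - 1) := by
    rw [lt_div_iff₀ (by linarith)]
    linarith
  set p := 1 / (γ - 1)
  have ha₀ : 0 < u₀ 0 := h₀.2.1 0 (Metric.mem_ball_self hR₀)
  have ha₁ : 0 < u₁ 0 := h₁.2.1 0 (Metric.mem_ball_self hR₁)
  set l : ℝ := (u₁ 0 / u₀ 0) ^ ((p - 1) / 2) with hl_def
  have hl : 0 < l := Real.rpow_pos_of_pos (div_pos ha₁ ha₀) _
  have hlp : l ^ (2 / (p - 1)) = u₁ 0 / u₀ 0 := by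
    rw [hl_def, ← Real.rpow_mul (div_pos ha₁ ha₀).le]
    have : p - 1 ≠ 0 := by linarith
    rw [div_mul_div_cancel₀ two_ne_zero, div_self this, Real.rpow_one]
  have hP₀ := (h₀.isLaneEmdenProfile hR₀).scale hp hl
  have hP₁ := h₁.isLaneEmdenProfile hR₁
  have hS : 0 < R₀ / l := div_pos hR₀ hl
  have hcenter : u₁ ((0 : ℝ) • EuclideanSpace.single 0 1)
      = l ^ (2 / (p - 1)) * u₀ ((l * 0) • EuclideanSpace.single 0 1) := by
    rw [hlp, mul_zero, zero_smul, div_mul_cancel₀ _ ha₀.ne']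
  have hR : R₁ = R₀ / l := le_antisymm
    (hP₀.radius_le hp.le hP₁ hcenter.symm hS hR₁) (hP₁.radius_le hp.le hP₀ hcenter hR₁ hS)
  refine ⟨l, hl, hR, fun x hx => ?_⟩
  rw [mem_closedBall_zero_iff] at hx
  have := hP₁.eqOn_Icc_min hp.le hP₀ hcenter hR₁ hS (x := ‖x‖)
    ⟨norm_nonneg x, le_min hx (hR ▸ hx)⟩
  beta_reduce at this
  rw [h₁.1 x (‖x‖ • EuclideanSpace.single 0 1)
      (by rw [norm_smul_single_zero, abs_of_nonneg (norm_nonneg x)]), this,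
    h₀.1 (l • x) ((l * ‖x‖) • EuclideanSpace.single 0 1)
      (by rw [norm_smul_single_zero, norm_smul, Real.norm_of_nonneg hl.le,
        abs_of_nonneg (by positivity)])]

open scoped Pointwise in
lemma setIntegral_ball_comp_smul (f : EuclideanSpace ℝ (Fin 3) → ℝ) {l R : ℝ} (hl : 0 < l) :
    ∫ x in Metric.ball (0 : EuclideanSpace ℝ (Fin 3)) (R / l), f (l • x)
      = (l ^ 3)⁻¹ * ∫ x in Metric.ball (0 : EuclideanSpace ℝ (Fin 3)) R, f x := by
  rw [Measure.setIntegral_comp_smul_of_pos volume f _ hl, _root_.smul_ball hl.ne', smul_zero,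
    Real.norm_of_nonneg hl.le, mul_div_cancel₀ _ hl.ne', finrank_euclideanSpace_fin, smul_eq_mul]

/-- For `6/5 < γ < 2`, `γ ≠ 4/3`, two Lane–Emden stars with the same total mass coincide:
the mass determines the star, since the central-value-to-mass map is strictly monotone. -/
theorem lane_emden_mass_determines_star
    (γ : ℝ) (hγ₁ : 6/5 < γ) (hγ₂ : γ < 2) (hγ₃ : γ ≠ 4/3)
    (R₀ R₁ : ℝ) (hR₀ : 0 < R₀) (hR₁ : 0 < R₁)
    (u₀ u₁ : EuclideanSpace ℝ (Fin 3) → ℝ)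
    (h₀ : IsLaneEmdenSolution γ R₀ u₀) (h₁ : IsLaneEmdenSolution γ R₁ u₁)
    (hmass :
      (∫ x in Metric.ball (0 : EuclideanSpace ℝ (Fin 3)) R₀, u₀ x ^ (1 / (γ - 1)))
        = ∫ x in Metric.ball (0 : EuclideanSpace ℝ (Fin 3)) R₁, u₁ x ^ (1 / (γ - 1))) :
    R₀ = R₁ ∧
      Set.EqOn u₀ u₁ (closure (Metric.ball (0 : EuclideanSpace ℝ (Fin 3)) R₀)) := by
  have hγ : 0 < γ - 1 := by linarith
  obtain ⟨l, hl, hR, hu⟩ := h₀.exists_scaling (by linarith) hγ₂ hR₀ hR₁ h₁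
  have hp : 1 < 1 / (γ - 1) := by
    rw [lt_div_iff₀ hγ]
    linarith
  have hp3 : 1 / (γ - 1) ≠ 3 := by
    intro h
    rw [div_eq_iff hγ.ne'] at h
    exact hγ₃ (by linarith)
  have hM := h₀.mass_pos hR₀ (by linarith)
  set p := 1 / (γ - 1)
  have hscaled : (∫ x in Metric.ball (0 : EuclideanSpace ℝ (Fin 3)) R₁, u₁ x ^ p)
      = l ^ (2 / (p - 1) * p - 3) *
        ∫ x in Metric.ball (0 : EuclideanSpace ℝ (Fin 3)) R₀, u₀ x ^ p := by
    calc (∫ x in Metric.ball (0 : EuclideanSpace ℝ (Fin 3)) R₁, u₁ x ^ p)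
        = ∫ x in Metric.ball (0 : EuclideanSpace ℝ (Fin 3)) R₁,
            l ^ (2 / (p - 1) * p) * u₀ (l • x) ^ p := by
          refine setIntegral_congr_fun measurableSet_ball fun x hx => ?_
          have hx' : 0 < u₀ (l • x) := by
            refine h₀.2.1 _ ?_
            rw [mem_ball_zero_iff, hR, lt_div_iff₀' hl] at hx
            rwa [mem_ball_zero_iff, norm_smul, Real.norm_of_nonneg hl.le]
          simp only [hu x (Metric.ball_subset_closedBall hx)]
          rw [Real.mul_rpow (by positivity) hx'.le, ← Real.rpow_mul hl.le]
      _ = _ := by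
          rw [integral_const_mul, hR, setIntegral_ball_comp_smul (fun x => u₀ x ^ p) hl,
            ← mul_assoc, Real.rpow_sub hl, Real.rpow_ofNat, ← div_eq_mul_inv]
  rw [hscaled] at hmass
  have hone : l ^ (2 / (p - 1) * p - 3) = 1 :=
    mul_right_cancel₀ hM.ne' (by rw [one_mul]; exact hmass.symm)
  have hexp : 2 / (p - 1) * p - 3 ≠ 0 := by
    have h1 : p - 1 ≠ 0 := by linarith
    intro h
    field_simp at h
    exact hp3 (by linarith)
  have hl1 : l = 1 :=
    (Real.rpow_left_inj hl.le zero_le_one hexp).1 (hone.trans (Real.one_rpow _).symm)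
  subst hl1
  rw [div_one] at hR
  refine ⟨hR.symm, fun x hx => ?_⟩
  rw [closure_ball _ hR₀.ne', ← hR] at hx
  simpa using (hu x hx).symm
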